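/- Let f be a folding instruction set and n ≥ 7. Then the length-n factor P_f[6·φ(n) : 6·φ(n)+n−1] is the last length-n factor to appear in P_f; that is, S_f(n) equals the least index j ≥ 1 at which the factor P_f[6·φ(n) : 6·φ(n)+n−1] occurs in P_f. -/

import Mathlib

/-- A folding instruction set: a sequence with values in {-1, 1}. -/
def FoldingSeq (f : ℕ → ℤ) : Prop := ∀ s, f s = 1 ∨ f s = -1

/-- The paper-folding sequence `P_f`: if `k = 2^s * r` with `r` odd, then
`P_f[k] = f s` if `r ≡ 1 [MOD 4]` and `P_f[k] = -f s` if `r ≡ 3 [MOD 4]`. -/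
def PF (f : ℕ → ℤ) (k : ℕ) : ℤ :=
  if (k / 2 ^ (padicValNat 2 k)) % 4 = 1 then f (padicValNat 2 k)
  else -f (padicValNat 2 k)

/-- The length-`n` factors of `P_f` starting at indices `i` and `j` are identical. -/
def FactorMatch (f : ℕ → ℤ) (n i j : ℕ) : Prop :=
  ∀ t, t < n → PF f (i + t) = PF f (j + t)

/-- `Sf f n` : the least positive integer `m` such that every length-`n` factor of `P_f`
starts somewhere within the first `m` positions. -/
noncomputable def Sf (f : ℕ → ℤ) (n : ℕ) : ℕ :=
  sInf {m | 1 ≤ m ∧ ∀ i, 1 ≤ i → ∃ j, 1 ≤ j ∧ j ≤ m ∧ FactorMatch f n i j}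

/-- `Af f n` : the least positive integer `m` such that every length-`n` factor of `P_f`
appears entirely within the prefix `P_f[1..m]`. -/
noncomputable def Af (f : ℕ → ℤ) (n : ℕ) : ℕ :=
  sInf {m | 1 ≤ m ∧ ∀ i, 1 ≤ i → ∃ j, 1 ≤ j ∧ j + n - 1 ≤ m ∧ FactorMatch f n i j}

/-- `phi2 n` : the least power of 2 that is `≥ n`, i.e. `2 ^ ⌈log₂ n⌉`. -/
def phi2 (n : ℕ) : ℕ := 2 ^ Nat.clog 2 n

theorem PF_two_pow_mul (f : ℕ → ℤ) (s r : ℕ) (hr : r % 2 = 1) :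
    PF f (2 ^ s * r) = if r % 4 = 1 then f s else -f s := by
  have hv : padicValNat 2 (2 ^ s * r) = s := by
    rw [padicValNat.mul (by positivity) (by omega), padicValNat.prime_pow,
      padicValNat.eq_zero_of_not_dvd (by omega), add_zero]
  rw [PF, hv, Nat.mul_div_cancel_left _ (by positivity)]

theorem PF_eq_one_or_neg_one {f : ℕ → ℤ} (hf : FoldingSeq f) (k : ℕ) :
    PF f k = 1 ∨ PF f k = -1 := by
  unfold PF
  rcases hf (padicValNat 2 k) with h | h <;> split_ifs <;> simp [h]

/-- Away from the multiples of `2 ^ k`, the sequence `P_f` has period `2 ^ (k + 1)`. -/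
theorem PF_add_period (f : ℕ → ℤ) {k m : ℕ} (hm : ¬ 2 ^ k ∣ m) (q : ℕ) :
    PF f (m + 2 ^ (k + 1) * q) = PF f m := by
  have hm0 : m ≠ 0 := by rintro rfl; exact hm (dvd_zero _)
  obtain ⟨s, r, hr, rfl⟩ := Nat.exists_eq_two_pow_mul_odd hm0
  have hsk : s < k := by
    by_contra! h
    exact hm (dvd_mul_of_dvd_left (pow_dvd_pow 2 h) r)
  obtain ⟨d, rfl⟩ : ∃ d, k = s + 1 + d := Nat.exists_eq_add_of_le hsk
  have hr2 : r % 2 = 1 := Nat.odd_iff.mp hr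
  have e : 2 ^ s * r + 2 ^ (s + 1 + d + 1) * q = 2 ^ s * (r + 4 * (2 ^ d * q)) := by ring
  have h4 : (r + 4 * (2 ^ d * q)) % 4 = r % 4 := by omega
  rw [e, PF_two_pow_mul f s _ (by omega), PF_two_pow_mul f s r hr2, h4]

theorem PF_eq_of_modEq (f : ℕ → ℤ) {k a b : ℕ} (ha : ¬ 2 ^ k ∣ a)
    (hab : a ≡ b [MOD 2 ^ (k + 1)]) : PF f a = PF f b := by
  wlog h : a ≤ b generalizing a b
  · refine (this (fun hb => ha ?_) hab.symm (by omega)).symm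
    exact (hab.dvd_iff (pow_dvd_pow 2 (Nat.le_succ k))).mpr hb
  obtain ⟨q, hq⟩ := (Nat.modEq_iff_dvd' h).mp hab
  rw [show b = a + 2 ^ (k + 1) * q by omega, PF_add_period f ha q]

/-- Two windows of length at most `2 ^ k`, placed alike around `c * 2 ^ k` and `c' * 2 ^ k`,
agree as soon as `c ≡ c' [MOD 2]` and these two positions carry the same value. -/
theorem factorMatch_of_mod_two (f : ℕ → ℤ) {k n i j d c c' : ℕ} (hn : n ≤ 2 ^ k)
    (hd : d < 2 ^ k) (hi : i + d = 2 ^ k * c) (hj : j + d = 2 ^ k * c')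
    (hc : c ≡ c' [MOD 2]) (hv : PF f (2 ^ k * c) = PF f (2 ^ k * c')) :
    FactorMatch f n i j := by
  intro t ht
  by_cases htd : t = d
  · rw [htd, hi, hj, hv]
  have hij : i ≡ j [MOD 2 ^ (k + 1)] := by
    refine Nat.ModEq.add_right_cancel' d ?_
    rw [hi, hj, pow_succ]
    exact hc.mul_left' _
  refine PF_eq_of_modEq f (k := k) (fun hdvd => htd ?_) (hij.add_right t)
  have h : i + t ≡ i + d [MOD 2 ^ k] := by
    rw [hi]
    exact ((Nat.modEq_zero_iff_dvd.mpr hdvd).trans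
      (Nat.modEq_zero_iff_dvd.mpr (dvd_mul_right _ c)).symm)
  exact (Nat.ModEq.add_left_cancel' i h).eq_of_lt_of_lt (by omega) hd

/-- A value `f s` at position `j + 2 ^ s` with `2 ^ (s + 1) ∣ j` forces `2 ^ (s + 2) ∣ j`. -/
theorem two_pow_dvd_of_PF_eq {f : ℕ → ℤ} (hf : FoldingSeq f) {s j : ℕ} (hj : 2 ^ (s + 1) ∣ j)
    (h : PF f (j + 2 ^ s) = f s) : 2 ^ (s + 2) ∣ j := by
  obtain ⟨q, rfl⟩ := hj
  rw [show 2 ^ (s + 1) * q + 2 ^ s = 2 ^ s * (2 * q + 1) by ring,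
    PF_two_pow_mul f s _ (by omega)] at h
  have hq : (2 * q + 1) % 4 = 1 := by
    by_contra hne
    rw [if_neg hne] at h
    rcases hf s with h1 | h1 <;> omega
  rw [show s + 2 = (s + 1) + 1 by ring, pow_succ]
  exact Nat.mul_dvd_mul_left _ (by omega)

theorem PF_six_mul_add (f : ℕ → ℤ) {k s : ℕ} (hs : s < k) :
    PF f (6 * 2 ^ k + 2 ^ s) = f s := by
  have hnd : ¬ 2 ^ k ∣ 2 ^ s := by
    rw [Nat.pow_dvd_pow_iff_le_right (by norm_num)]
    omega
  rw [show 6 * 2 ^ k + 2 ^ s = 2 ^ s + 2 ^ (k + 1) * 3 by ring, PF_add_period f hnd]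
  simpa using PF_two_pow_mul f s 1 rfl

theorem two_pow_dvd_of_factorMatch {f : ℕ → ℤ} (hf : FoldingSeq f) {k n j : ℕ} (hn : 7 ≤ n)
    (hk : 3 ≤ k) (hkn : 2 ^ (k - 1) < n) (h : FactorMatch f n (6 * 2 ^ k) j) :
    2 ^ (k + 1) ∣ j := by
  have heven : 2 ∣ j := by
    by_contra hodd
    have h2 := h 2 (by omega)
    have h6 := h 6 (by omega)
    have hper : PF f (j + 6) = PF f (j + 2) :=
      PF_add_period f (k := 1) (m := j + 2) (by omega) 1
    have e2 : PF f (6 * 2 ^ k + 2) = f 1 := PF_six_mul_add f (s := 1) (by omega)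
    have e6 : PF f (6 * 2 ^ k + 6) = -f 1 := by
      have hnd : ¬ 2 ^ k ∣ 6 := fun hd => by
        have h8 : 8 ∣ 6 := (pow_dvd_pow 2 hk).trans hd
        omega
      rw [show 6 * 2 ^ k + 6 = 6 + 2 ^ (k + 1) * 3 by ring, PF_add_period f hnd]
      simpa using PF_two_pow_mul f 1 3 rfl
    rcases hf 1 with h1 | h1 <;> omega
  have hstep : ∀ s, s ≤ k → 2 ^ (s + 1) ∣ j := by
    intro s
    induction s with
    | zero => intro _; simpa using heven
    | succ s ih =>
      intro hs
      have hlt : 2 ^ s < n := (Nat.pow_le_pow_right (by norm_num) (by omega)).trans_lt hkn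
      exact two_pow_dvd_of_PF_eq hf (ih (by omega))
        ((h _ hlt).symm.trans (PF_six_mul_add f hs))
  exact hstep k le_rfl

theorem PF_six_mul (f : ℕ → ℤ) (k : ℕ) : PF f (2 ^ k * 6) = -f (k + 1) := by
  rw [show 2 ^ k * 6 = 2 ^ (k + 1) * 3 by ring]
  simpa using PF_two_pow_mul f (k + 1) 3 rfl

theorem PF_two_mul (f : ℕ → ℤ) (k : ℕ) : PF f (2 ^ k * 2) = f (k + 1) := by
  rw [show 2 ^ k * 2 = 2 ^ (k + 1) * 1 by ring]
  simpa using PF_two_pow_mul f (k + 1) 1 rfl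

theorem PF_four_mul (f : ℕ → ℤ) (k : ℕ) : PF f (2 ^ k * 4) = f (k + 2) := by
  rw [show 2 ^ k * 4 = 2 ^ (k + 2) * 1 by ring]
  simpa using PF_two_pow_mul f (k + 2) 1 rfl

/-- If `e ∈ {4, 6}` is such that `P_f` takes the value `-f (k + 1)` at `2 ^ k * e`, then every
factor of length at most `2 ^ k` starts within the first `2 ^ k * e` positions. -/
theorem exists_factorMatch_le {f : ℕ → ℤ} (hf : FoldingSeq f) {k n e : ℕ} (hn : n ≤ 2 ^ k)
    (he : e = 4 ∨ e = 6) (hv : PF f (2 ^ k * e) = -f (k + 1)) {i : ℕ} (hi : 1 ≤ i) :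
    ∃ j, 1 ≤ j ∧ j ≤ 2 ^ k * e ∧ FactorMatch f n i j := by
  have hpos : 0 < 2 ^ k := by positivity
  obtain ⟨c, d, hd, hid⟩ : ∃ c d, d < 2 ^ k ∧ i + d = 2 ^ k * c := by
    refine ⟨(i + 2 ^ k - 1) / 2 ^ k, 2 ^ k - 1 - (i + 2 ^ k - 1) % 2 ^ k, by omega, ?_⟩
    have h1 := Nat.div_add_mod (i + 2 ^ k - 1) (2 ^ k)
    have h2 := Nat.mod_lt (i + 2 ^ k - 1) hpos
    omega
  obtain ⟨c', hc1, hce, hcc, hcv⟩ : ∃ c', 1 ≤ c' ∧ c' ≤ e ∧ c ≡ c' [MOD 2] ∧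
      PF f (2 ^ k * c) = PF f (2 ^ k * c') := by
    have hpm := PF_eq_one_or_neg_one hf (2 ^ k * c)
    rcases Nat.mod_two_eq_zero_or_one c with hc | hc
    · have h2 := PF_two_mul f k
      by_cases hcv : PF f (2 ^ k * c) = f (k + 1)
      · exact ⟨2, by omega, by omega, hc, by omega⟩
      · refine ⟨e, by omega, le_rfl, ?_, ?_⟩
        · rcases he with rfl | rfl <;> exact hc
        · rcases hf (k + 1) with h | h <;> omega
    · have h1 : PF f (2 ^ k * 1) = f k := by simpa using PF_two_pow_mul f k 1 rfl
      have h3 : PF f (2 ^ k * 3) = -f k := by simpa using PF_two_pow_mul f k 3 rfl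
      by_cases hcv : PF f (2 ^ k * c) = f k
      · exact ⟨1, by omega, by omega, hc, by omega⟩
      · refine ⟨3, by omega, by omega, hc, ?_⟩
        rcases hf k with h | h <;> omega
  have hle : 2 ^ k * 1 ≤ 2 ^ k * c' := Nat.mul_le_mul_left _ hc1
  have hle' : 2 ^ k * c' ≤ 2 ^ k * e := Nat.mul_le_mul_left _ hce
  exact ⟨2 ^ k * c' - d, by omega, by omega,
    factorMatch_of_mod_two f hn hd hid (by omega) hcc hcv⟩

theorem stmt5 (f : ℕ → ℤ) (hf : FoldingSeq f) (n : ℕ) (hn : 7 ≤ n) :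
    Sf f n = sInf {j | 1 ≤ j ∧ FactorMatch f n (6 * phi2 n) j} := by
  unfold phi2
  set k := Nat.clog 2 n
  have hnk : n ≤ 2 ^ k := Nat.le_pow_clog (by norm_num) n
  have hk : 3 ≤ k := by
    by_contra! h
    have : 2 ^ k ≤ 2 ^ 2 := Nat.pow_le_pow_right (by norm_num) (by omega)
    omega
  have hkn : 2 ^ (k - 1) < n := Nat.pow_pred_clog_lt_self (by norm_num) (by omega)
  have hpos : 0 < 2 ^ k := by positivity
  have h6 := PF_six_mul f k
  obtain ⟨e, he, hv, hmin⟩ : ∃ e, (e = 4 ∨ e = 6) ∧ PF f (2 ^ k * e) = -f (k + 1) ∧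
      ∀ q, 1 ≤ q → PF f (2 ^ k * (2 * q)) = -f (k + 1) → e ≤ 2 * q := by
    have hne2 : PF f (2 ^ k * 2) ≠ -f (k + 1) := by
      rw [PF_two_mul]
      rcases hf (k + 1) with h | h <;> omega
    by_cases h4 : PF f (2 ^ k * 4) = -f (k + 1)
    · refine ⟨4, Or.inl rfl, h4, fun q hq h => ?_⟩
      by_contra! hlt
      obtain rfl : q = 1 := by omega
      exact hne2 h
    · refine ⟨6, Or.inr rfl, h6, fun q hq h => ?_⟩
      by_contra! hlt
      obtain rfl | rfl : q = 1 ∨ q = 2 := by omega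
      · exact hne2 h
      · exact h4 h
  have hlower : ∀ j, 1 ≤ j → FactorMatch f n (6 * 2 ^ k) j → 2 ^ k * e ≤ j := by
    intro j hj hm
    obtain ⟨q, rfl⟩ := two_pow_dvd_of_factorMatch hf hn hk hkn hm
    have hq : 1 ≤ q := Nat.pos_of_ne_zero (by rintro rfl; omega)
    have h0 := hm 0 (by omega)
    have hj2 : 2 ^ (k + 1) * q = 2 ^ k * (2 * q) := by ring
    rw [add_zero, add_zero, mul_comm 6, h6, hj2] at h0
    rw [hj2]
    exact Nat.mul_le_mul_left _ (hmin q hq h0.symm)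
  have hepos : 1 ≤ 2 ^ k * e := by
    have : 2 ^ k * 1 ≤ 2 ^ k * e := Nat.mul_le_mul_left _ (by omega)
    omega
  have hS : IsLeast {m | 1 ≤ m ∧ ∀ i, 1 ≤ i → ∃ j, 1 ≤ j ∧ j ≤ m ∧ FactorMatch f n i j}
      (2 ^ k * e) := by
    refine ⟨⟨hepos, fun i hi => exists_factorMatch_le hf hnk he hv hi⟩, ?_⟩
    rintro m ⟨-, hm⟩
    obtain ⟨j, hj, hjm, hmatch⟩ := hm (6 * 2 ^ k) (by omega)
    exact (hlower j hj hmatch).trans hjm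
  have hJ : IsLeast {j | 1 ≤ j ∧ FactorMatch f n (6 * 2 ^ k) j} (2 ^ k * e) := by
    refine ⟨⟨hepos, ?_⟩, fun j hj => hlower j hj.1 hj.2⟩
    refine factorMatch_of_mod_two f hnk hpos (mul_comm 6 _) (add_zero _) ?_ (h6.trans hv.symm)
    rcases he with rfl | rfl <;> rfl
  exact hS.csInf_eq.trans hJ.csInf_eq.symm
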